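/- arXiv:2509.09220 — 3 statements merged into one kernel-verified Lean document; each statement's English description precedes it below -/
import Mathlib

section
/- Let A = σ(R)⟨x_1,…,x_n⟩ be a skew PBW extension of a ring R, where R is (Σ,Δ)-compatible, Abelian, NI, and satisfies condition (SA1). If R is a right p.p.-ring, then A is a right p.p.-ring. -/
/-! Basic annihilator-condition definitions for (noncommutative) rings. -/

/-- The right annihilator `r_S(X) = {a ∈ S | Xa = 0}` of a subset `X` of a ring `S`. -/
def rAnn {S : Type*} [Ring S] (X : Set S) : Set S := {a | ∀ x ∈ X, x * a = 0}

/-- The left annihilator `ℓ_S(X) = {a ∈ S | aX = 0}` of a subset `X` of a ring `S`. -/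
def lAnn {S : Type*} [Ring S] (X : Set S) : Set S := {a | ∀ x ∈ X, a * x = 0}

/-- The principal right ideal `xS` of a ring `S`. -/
def rIdeal {S : Type*} [Ring S] (x : S) : Set S := Set.range fun s => x * s

/-- The principal left ideal `Sx` of a ring `S`. -/
def lIdeal {S : Type*} [Ring S] (x : S) : Set S := Set.range fun s => s * x

/-- A ring `S` is Baer if the right annihilator of every nonempty subset is
generated (as a right ideal) by an idempotent. -/
def IsBaerRing (S : Type*) [Ring S] : Prop :=
  ∀ X : Set S, X.Nonempty → ∃ e : S, e * e = e ∧ rAnn X = rIdeal e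

/-- A ring `S` is a right p.p.-ring if the right annihilator of every element is
generated by an idempotent. -/
def IsRightPP (S : Type*) [Ring S] : Prop :=
  ∀ a : S, ∃ e : S, e * e = e ∧ rAnn {a} = rIdeal e

/-- A ring `S` is a left p.p.-ring if the left annihilator of every element is
generated by an idempotent. -/
def IsLeftPP (S : Type*) [Ring S] : Prop :=
  ∀ a : S, ∃ e : S, e * e = e ∧ lAnn {a} = lIdeal e

/-- A ring `S` is right p.q.-Baer if the right annihilator of every principal right
ideal is generated by an idempotent. -/
def IsRightPQBaer (S : Type*) [Ring S] : Prop :=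
  ∀ a : S, ∃ e : S, e * e = e ∧ rAnn (rIdeal a) = rIdeal e

/-- A ring `S` is left p.q.-Baer if the left annihilator of every principal left
ideal is generated by an idempotent. -/
def IsLeftPQBaer (S : Type*) [Ring S] : Prop :=
  ∀ a : S, ∃ e : S, e * e = e ∧ lAnn (lIdeal a) = lIdeal e

/-- Property (a.c.) on the right: for every finitely generated right ideal
`I = a₁S + ⋯ + a_mS` there is `c` with `r_S(I) = r_S(cS)`. -/
def HasRightAC (S : Type*) [Ring S] : Prop :=
  ∀ (m : ℕ) (a : Fin m → S), ∃ c : S,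
    rAnn {y : S | ∃ s : Fin m → S, y = ∑ i, a i * s i} = rAnn (rIdeal c)

/-- Property (a.c.) on the left: for every finitely generated left ideal
`I = Sa₁ + ⋯ + Sa_m` there is `c` with `ℓ_S(I) = ℓ_S(Sc)`. -/
def HasLeftAC (S : Type*) [Ring S] : Prop :=
  ∀ (m : ℕ) (a : Fin m → S), ∃ c : S,
    lAnn {y : S | ∃ s : Fin m → S, y = ∑ i, s i * a i} = lAnn (lIdeal c)

/-- A ring is Abelian if every idempotent is central. -/
def IsAbelianRing (S : Type*) [Ring S] : Prop :=
  ∀ e : S, e * e = e → ∀ r : S, e * r = r * e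

/-- A ring `S` is NI if the set of nilpotent elements coincides with the upper
nilradical `nil*(S)`, the sum of all (two-sided) nil ideals of `S`. -/
def IsNIRing (S : Type*) [Ring S] : Prop :=
  {a : S | IsNilpotent a} =
    ((sSup {I : TwoSidedIdeal S | ∀ x ∈ I, IsNilpotent x} : TwoSidedIdeal S) : Set S)

/-- `σ^α = σ₁^{α₁} ∘ ⋯ ∘ σₙ^{αₙ}` for a family of ring endomorphisms. -/
def sigmaPow {R : Type*} [Ring R] {n : ℕ} (σ : Fin n → R →+* R) (α : Fin n → ℕ) : R → R :=
  (List.ofFn fun i => (⇑(σ i))^[α i]).foldr (· ∘ ·) id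

/-- `δ^α = δ₁^{α₁} ∘ ⋯ ∘ δₙ^{αₙ}` for a family of maps. -/
def deltaPow {R : Type*} {n : ℕ} (δ : Fin n → R → R) (α : Fin n → ℕ) : R → R :=
  (List.ofFn fun i => (δ i)^[α i]).foldr (· ∘ ·) id

/-- The ordered standard monomial `x^α = x₁^{α₁} ⋯ xₙ^{αₙ}`. -/
def monom {A : Type*} [Ring A] {n : ℕ} (x : Fin n → A) (α : Fin n → ℕ) : A :=
  (List.ofFn fun i => x i ^ α i).prod

/-- A skew PBW extension `A = σ(R)⟨x₁,…,xₙ⟩` of a ring `R`: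
`R` embeds in `A` (sharing the identity), `A` is a free left `R`-module with basis the
standard monomials, there are injective endomorphisms `σᵢ` and `σᵢ`-derivations `δᵢ`
with `xᵢ r = σᵢ(r) xᵢ + δᵢ(r)`, and `xⱼxᵢ - d_{i,j} xᵢxⱼ ∈ R + Rx₁ + ⋯ + Rxₙ`
with `d_{i,j} ≠ 0`. -/
structure SkewPBWExt (R A : Type*) [Ring R] [Ring A] (n : ℕ) where
  /-- the inclusion of `R` into `A` -/
  ι : R →+* A
  ι_inj : Function.Injective ι
  /-- the variables `x₁, …, xₙ` -/
  x : Fin n → A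
  /-- the endomorphisms `σᵢ` -/
  σ : Fin n → R →+* R
  σ_inj : ∀ i, Function.Injective (σ i)
  /-- the `σᵢ`-derivations `δᵢ` -/
  δ : Fin n → R → R
  δ_add : ∀ (i : Fin n) (a b : R), δ i (a + b) = δ i a + δ i b
  δ_leibniz : ∀ (i : Fin n) (a b : R), δ i (a * b) = σ i a * δ i b + δ i a * b
  comm_rel : ∀ (i : Fin n) (r : R), x i * ι r = ι (σ i r) * x i + ι (δ i r)
  /-- `A` is a free left `R`-module with basis the standard monomials: every element
  has a unique representation as a finite left `R`-linear combination of monomials. -/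
  basis : ∀ f : A, ∃! c : (Fin n → ℕ) →₀ R, f = c.sum fun α r => ι r * monom x α
  /-- the constants `d_{i,j}` -/
  d : Fin n → Fin n → R
  d_ne : ∀ i j, d i j ≠ 0
  quad : ∀ i j, ∃ (r0 : R) (rc : Fin n → R),
    x j * x i - ι (d i j) * (x i * x j) = ι r0 + ∑ k, ι (rc k) * x k

namespace SkewPBWExt

variable {R A : Type*} [Ring R] [Ring A] {n : ℕ}

/-- `R` is `(Σ,Δ)`-compatible. -/
def SigmaDeltaCompatible (E : SkewPBWExt R A n) : Prop :=
  ∀ (a b : R) (α : Fin n → ℕ),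
    (a * b = 0 ↔ a * sigmaPow E.σ α b = 0) ∧ (a * b = 0 → a * deltaPow E.δ α b = 0)

/-- `R` is `Σ`-rigid. -/
def SigmaRigid (E : SkewPBWExt R A n) : Prop :=
  ∀ (a : R) (α : Fin n → ℕ), a * sigmaPow E.σ α a = 0 → a = 0

/-- Condition (SA1): if `fg = 0` in `A` then all products of coefficients vanish. -/
def SA1 (E : SkewPBWExt R A n) : Prop :=
  ∀ cf cg : (Fin n → ℕ) →₀ R,
    (cf.sum fun α r => E.ι r * monom E.x α) * (cg.sum fun β r => E.ι r * monom E.x β) = 0 →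
    ∀ α β, cf α * cg β = 0

/-- The extension is bijective: every `σᵢ` is bijective and every `d_{i,j}` (`i < j`)
is invertible in `R`. -/
def Bijective (E : SkewPBWExt R A n) : Prop :=
  (∀ i, Function.Bijective (E.σ i)) ∧ ∀ i j : Fin n, i < j → IsUnit (E.d i j)

end SkewPBWExt


theorem foldr_comp_ofFn_eq_of_forall_ne {R : Type*} {n : ℕ} (f : Fin n → R → R) (i : Fin n)
    (hf : ∀ j, j ≠ i → f j = id) : (List.ofFn f).foldr (· ∘ ·) id = f i := by
  induction n with
  | zero => exact i.elim0
  | succ n ih =>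
    rw [List.ofFn_succ, List.foldr_cons]
    induction i using Fin.cases with
    | zero =>
      have h : ∀ l : List (R → R), (∀ g ∈ l, g = id) → l.foldr (· ∘ ·) id = id := by
        intro l hl
        induction l with
        | nil => rfl
        | cons g l ihl =>
          rw [List.foldr_cons, ihl fun g hg => hl g (List.mem_cons_of_mem _ hg),
            hl g List.mem_cons_self]
          rfl
      rw [h]
      · rfl
      · intro g hg
        obtain ⟨j, rfl⟩ := List.mem_ofFn.1 hg
        exact hf _ (Fin.succ_ne_zero j)
    | succ i =>
      rw [ih (fun j => f j.succ) i fun j hj => hf _ fun h => hj (Fin.succ_injective _ h),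
        hf 0 (Fin.succ_ne_zero i).symm]
      rfl

theorem sigmaPow_single {R : Type*} [Ring R] {n : ℕ} (σ : Fin n → R →+* R) (i : Fin n) :
    sigmaPow σ (Pi.single i 1) = σ i := by
  rw [sigmaPow, foldr_comp_ofFn_eq_of_forall_ne _ i]
  · simp
  · intro j hj
    simp [hj]

theorem deltaPow_single {R : Type*} {n : ℕ} (δ : Fin n → R → R) (i : Fin n) :
    deltaPow δ (Pi.single i 1) = δ i := by
  rw [deltaPow, foldr_comp_ofFn_eq_of_forall_ne _ i]
  · simp
  · intro j hj
    simp [hj]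

theorem commute_monom {A : Type*} [Ring A] {n : ℕ} {x : Fin n → A} {a : A}
    (h : ∀ i, Commute a (x i)) (α : Fin n → ℕ) : Commute a (monom x α) := by
  refine Commute.list_prod_right _ _ fun y hy => ?_
  obtain ⟨i, rfl⟩ := List.mem_ofFn.1 hy
  exact (h i).pow_right _

/-- In an Abelian right p.p.-ring the right annihilator of a finite set is generated by an
idempotent. -/
theorem IsRightPP.exists_idempotent_finset {R : Type*} [Ring R] (hAb : IsAbelianRing R)
    (hpp : IsRightPP R) (s : Finset R) :
    ∃ e : R, e * e = e ∧ (∀ a ∈ s, a * e = 0) ∧ ∀ b, (∀ a ∈ s, a * b = 0) → e * b = b := by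
  classical
  induction s using Finset.induction_on with
  | empty => exact ⟨1, by simp, by simp, by simp⟩
  | insert a s _ ih =>
    obtain ⟨e, he, hes, heb⟩ := ih
    obtain ⟨u, hu, hua⟩ := hpp a
    have hau : a * u = 0 := by
      have h : u ∈ rAnn {a} := hua ▸ ⟨1, mul_one u⟩
      exact h a rfl
    refine ⟨u * e, ?_, ?_, ?_⟩
    · rw [mul_assoc, ← mul_assoc e, ← hAb u hu e, mul_assoc, he, ← mul_assoc, hu]
    · intro c hc
      rcases Finset.mem_insert.1 hc with rfl | hc
      · rw [← mul_assoc, hau, zero_mul]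
      · rw [hAb u hu e, ← mul_assoc, hes c hc, zero_mul]
    · intro b hb
      have hub : b ∈ rIdeal u := by
        rw [← hua]
        rintro _ rfl
        exact hb _ (Finset.mem_insert_self _ _)
      obtain ⟨r, rfl⟩ := hub
      have h := heb _ fun c hc => hb c (Finset.mem_insert_of_mem hc)
      rw [mul_assoc, h]
      simp only [← mul_assoc, hu]

namespace SkewPBWExt

variable {R A : Type*} [Ring R] [Ring A] {n : ℕ} {E : SkewPBWExt R A n} {e : R}

theorem SigmaDeltaCompatible.sigma_idempotent (hcomp : E.SigmaDeltaCompatible)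
    (he : e * e = e) (i : Fin n) : E.σ i e = e := by
  have h₁ := (hcomp (1 - e) e (Pi.single i 1)).1.1 (by rw [sub_mul, one_mul, he, sub_self])
  have h₂ := (hcomp e (1 - e) (Pi.single i 1)).1.1 (by rw [mul_sub, mul_one, he, sub_self])
  rw [sigmaPow_single, sub_mul, one_mul, sub_eq_zero] at h₁
  rw [sigmaPow_single, map_sub, map_one, mul_sub, mul_one, sub_eq_zero] at h₂
  exact h₁.trans h₂.symm

theorem delta_one (E : SkewPBWExt R A n) (i : Fin n) : E.δ i 1 = 0 := by
  simpa using E.δ_leibniz i 1 1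

theorem SigmaDeltaCompatible.delta_idempotent (hcomp : E.SigmaDeltaCompatible)
    (he : e * e = e) (i : Fin n) : E.δ i e = 0 := by
  have h₁ := (hcomp (1 - e) e (Pi.single i 1)).2 (by rw [sub_mul, one_mul, he, sub_self])
  have h₂ := (hcomp e (1 - e) (Pi.single i 1)).2 (by rw [mul_sub, mul_one, he, sub_self])
  have h₃ : E.δ i e + E.δ i (1 - e) = 0 := by
    rw [← E.δ_add, add_sub_cancel, E.delta_one]
  rw [deltaPow_single, sub_mul, one_mul, sub_eq_zero] at h₁
  rw [deltaPow_single, eq_neg_of_add_eq_zero_right h₃, mul_neg, neg_eq_zero] at h₂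
  exact h₁.trans h₂

theorem SigmaDeltaCompatible.commute_monom_idempotent (hcomp : E.SigmaDeltaCompatible)
    (he : e * e = e) (α : Fin n → ℕ) : Commute (E.ι e) (monom E.x α) := by
  refine commute_monom (fun i => ?_) α
  have h := E.comm_rel i e
  rw [hcomp.sigma_idempotent he, hcomp.delta_idempotent he, map_zero, add_zero] at h
  exact h.symm

end SkewPBWExt

/-- If `R` is `(Σ,Δ)`-compatible, Abelian, NI, satisfies (SA1) and is a right
p.p.-ring, then the skew PBW extension `A` is a right p.p.-ring. -/
theorem rightPP_isRightPP {R A : Type*} [Ring R] [Ring A] {n : ℕ} (E : SkewPBWExt R A n)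
    (hcomp : E.SigmaDeltaCompatible) (hAb : IsAbelianRing R) (hNI : IsNIRing R)
    (hSA1 : E.SA1) (hpp : IsRightPP R) :
    IsRightPP A := by
  intro f
  obtain ⟨c, hf, -⟩ := E.basis f
  classical
  obtain ⟨e, he, hce, heb⟩ := hpp.exists_idempotent_finset hAb (c.support.image c)
  have hfe : f * E.ι e = 0 := by
    rw [hf, Finsupp.sum, Finset.sum_mul]
    refine Finset.sum_eq_zero fun α hα => ?_
    rw [mul_assoc, ← (hcomp.commute_monom_idempotent he α).eq, ← mul_assoc, ← map_mul,
      hce _ (Finset.mem_image_of_mem c hα), map_zero, zero_mul]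
  refine ⟨E.ι e, by rw [← map_mul, he], Set.ext fun g => ⟨fun hg => ⟨g, ?_⟩, ?_⟩⟩
  · obtain ⟨b, hb, -⟩ := E.basis g
    have h := hSA1 c b (by rw [← hf, ← hb]; exact hg f rfl)
    change E.ι e * g = g
    rw [hb, Finsupp.sum, Finset.mul_sum]
    refine Finset.sum_congr rfl fun β _ => ?_
    rw [← mul_assoc, ← map_mul, heb (b β)]
    intro a ha
    obtain ⟨α, -, rfl⟩ := Finset.mem_image.1 ha
    exact h α β
  · rintro ⟨r, rfl⟩ _ rfl
    rw [← mul_assoc, hfe, zero_mul]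
end

section
/- Let A = σ(R)⟨x_1,…,x_n⟩ be a skew PBW extension of a ring R. If R is (Σ,Δ)-compatible, Abelian, and NI, then A is an Abelian ring (every idempotent of A is central). -/
theorem List.prod_ofFn_update_mul {M : Type*} [Monoid M] {n : ℕ} (g : Fin n → M) (j : Fin n)
    (y : M) (hg : ∀ k < j, g k = 1) :
    (List.ofFn (Function.update g j (y * g j))).prod = y * (List.ofFn g).prod := by
  induction n with
  | zero => exact j.elim0
  | succ n ih =>
    rw [List.ofFn_succ, List.ofFn_succ, List.prod_cons, List.prod_cons]
    induction j using Fin.cases with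
    | zero => simp [mul_assoc]
    | succ j =>
      have h0 : g 0 = 1 := hg 0 (Fin.succ_pos j)
      have hu : (fun i : Fin n => Function.update g j.succ (y * g j.succ) i.succ) =
          Function.update (fun i => g i.succ) j (y * g j.succ) :=
        Function.update_comp_eq_of_injective g (Fin.succ_injective n) j _
      rw [Function.update_of_ne (Fin.succ_ne_zero j).symm, hu, h0, one_mul, one_mul]
      exact ih (fun i => g i.succ) j fun k hk => hg _ (Fin.succ_lt_succ_iff.2 hk)

theorem monom_add_single {A : Type*} [Ring A] {n : ℕ} (x : Fin n → A) (β : Fin n → ℕ)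
    (j : Fin n) (hβ : ∀ k < j, β k = 0) :
    monom x (β + Pi.single j 1) = x j * monom x β := by
  unfold monom
  rw [← List.prod_ofFn_update_mul _ j (x j) fun k hk => by simp [hβ k hk]]
  congr 2
  funext i
  by_cases h : i = j
  · subst h
    simp [pow_succ']
  · simp [h]

theorem foldr_comp_ofFn_iterate_single {R : Type*} {n : ℕ} (g : Fin n → R → R) (i : Fin n) :
    (List.ofFn fun k => (g k)^[(Pi.single i 1 : Fin n → ℕ) k]).foldr (· ∘ ·) id = g i := by
  let y : Function.End R := g i
  have h := List.prod_ofFn_update_mul (fun _ => (1 : Function.End R)) i y fun _ _ => rfl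
  rw [List.ofFn_const, List.prod_replicate, one_pow, mul_one] at h
  have hu : Function.update (fun _ => (1 : Function.End R)) i y =
      fun k => (g k)^[(Pi.single i 1 : Fin n → ℕ) k] := by
    funext k
    by_cases hk : k = i
    · subst hk
      rw [Function.update_self, Pi.single_eq_same]
      rfl
    · simp only [ne_eq, hk, not_false_eq_true, Function.update_of_ne, Pi.single_eq_of_ne]
      rfl
  rw [hu] at h
  exact h

/-- Over a ring with a two-sided ideal `N` of nilpotent elements, a finite row vector fixed by a
square matrix with entries in `N` vanishes. -/
theorem TwoSidedIdeal.eq_zero_of_eq_sum_mul {R κ : Type*} [Ring R] [DecidableEq κ]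
    {N : TwoSidedIdeal R} (hN : ∀ a ∈ N, IsNilpotent a) (s : Finset κ) (r : κ → R)
    (a : κ → κ → R) (ha : ∀ i j, a i j ∈ N) (hr : ∀ j ∈ s, r j = ∑ i ∈ s, r i * a i j) :
    ∀ j ∈ s, r j = 0 := by
  induction s using Finset.induction_on generalizing a with
  | empty => simp
  | insert k s hk ih =>
    simp only [Finset.sum_insert hk] at hr
    obtain ⟨v, hv⟩ := (hN _ (ha k k)).isUnit_one_sub.exists_right_inv
    have hrk : r k = ∑ i ∈ s, r i * (a i k * v) := by
      have h : r k * (1 - a k k) = ∑ i ∈ s, r i * a i k := by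
        rw [mul_sub, mul_one, sub_eq_iff_eq_add']
        exact hr k (Finset.mem_insert_self k s)
      calc r k = r k * (1 - a k k) * v := by rw [mul_assoc, hv, mul_one]
        _ = _ := by simp only [h, Finset.sum_mul, mul_assoc]
    have hs : ∀ j ∈ s, r j = 0 := by
      refine ih (fun i j => a i k * v * a k j + a i j)
        (fun i j => N.add_mem (N.mul_mem_left _ _ (ha k j)) (ha i j)) fun j hj => ?_
      have h := hr j (Finset.mem_insert_of_mem hj)
      rw [h]
      nth_rw 1 [hrk]
      simp only [Finset.sum_mul, mul_add, Finset.sum_add_distrib, mul_assoc]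
    intro j hj
    rcases Finset.mem_insert.1 hj with rfl | hj
    · rw [hrk]
      exact Finset.sum_eq_zero fun i hi => by rw [hs i hi, zero_mul]
    · exact hs j hj

theorem pow_eq_zero_of_forall_mul_mul {R : Type*} [Ring R] {p q : R}
    (h : ∀ u v : R, u * p * v = 0 → u * q * v = 0) {k : ℕ} (hp : p ^ k = 0) : q ^ k = 0 := by
  suffices ∀ j ≤ k, q ^ j * p ^ (k - j) = 0 by simpa using this k le_rfl
  intro j
  induction j with
  | zero => simpa using hp
  | succ j ih =>
    intro hj
    have h1 := ih (by omega)
    rw [show k - j = (k - (j + 1)) + 1 by omega, pow_succ', ← mul_assoc] at h1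
    rw [pow_succ]
    exact h _ _ h1

theorem IsAbelianRing.isUnit_of_mul_eq_one {R : Type*} [Ring R] (hAb : IsAbelianRing R) {a b : R}
    (h : a * b = 1) : IsUnit b := by
  have h1 : b * a * (b * a) = b * a := by rw [mul_assoc, ← mul_assoc a, h, one_mul]
  have h2 := hAb _ h1 a
  have h3 : b * a = 1 := by
    calc b * a = b * a * (a * b) := by rw [h, mul_one]
      _ = a * (b * a) * b := by rw [← mul_assoc, h2]
      _ = 1 := by rw [← mul_assoc, h, one_mul, h]
  exact ⟨⟨b, a, h3, h⟩, rfl⟩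

namespace SkewPBWExt

variable {R A : Type*} [Ring R] [Ring A] {n : ℕ} (E : SkewPBWExt R A n)

/-- The left `R`-linear combination of standard monomials with given coefficients. -/
noncomputable def lcHom : ((Fin n → ℕ) →₀ R) →+ A :=
  Finsupp.liftAddHom fun α => (AddMonoidHom.mulRight (monom E.x α)).comp E.ι.toAddMonoidHom

theorem lcHom_apply (c : (Fin n → ℕ) →₀ R) :
    E.lcHom c = c.sum fun α r => E.ι r * monom E.x α := rfl

theorem lcHom_bijective : Function.Bijective E.lcHom := by
  rw [Function.bijective_iff_existsUnique]
  intro f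
  simpa only [lcHom_apply, eq_comm] using E.basis f

/-- The coefficients of an element of `A` on the standard monomials. -/
noncomputable def repr : A ≃+ ((Fin n → ℕ) →₀ R) :=
  (AddEquiv.ofBijective E.lcHom E.lcHom_bijective).symm

theorem repr_ι_mul_monom (r : R) (α : Fin n → ℕ) :
    E.repr (E.ι r * monom E.x α) = Finsupp.single α r := by
  rw [repr, AddEquiv.symm_apply_eq]
  change _ = E.lcHom _
  simp [lcHom_apply]

theorem eq_sum_repr (f : A) :
    f = ∑ α ∈ (E.repr f).support, E.ι (E.repr f α) * monom E.x α :=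
  ((AddEquiv.ofBijective E.lcHom E.lcHom_bijective).apply_symm_apply f).symm

theorem repr_monom (α : Fin n → ℕ) : E.repr (monom E.x α) = Finsupp.single α 1 := by
  simpa using E.repr_ι_mul_monom 1 α

theorem repr_ι_mul (r : R) (f : A) (α : Fin n → ℕ) :
    E.repr (E.ι r * f) α = r * E.repr f α := by
  classical
  conv_lhs => rw [E.eq_sum_repr f]
  simp only [Finset.mul_sum, ← mul_assoc, ← map_mul, map_sum, repr_ι_mul_monom,
    Finsupp.finsetSum_apply, Finsupp.single_apply]
  by_cases h : E.repr f α = 0 <;> simp [h]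

theorem repr_ι (r : R) : E.repr (E.ι r) = Finsupp.single 0 r := by
  simpa [monom] using E.repr_ι_mul_monom r 0

theorem mem_subring {S : Subring A} (hι : ∀ r, E.ι r ∈ S) (hx : ∀ i, E.x i ∈ S) (a : A) :
    a ∈ S := by
  rw [E.eq_sum_repr a]
  refine S.sum_mem fun α _ => S.mul_mem (hι _) (S.list_prod_mem fun y hy => ?_)
  obtain ⟨i, rfl⟩ := (List.mem_ofFn' _ _).1 hy
  exact S.pow_mem (hx i) _

/-- The elements of `A` all of whose coefficients lie in `N`. -/
def coeffMem (N : TwoSidedIdeal R) : AddSubgroup A where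
  carrier := {f | ∀ α, E.repr f α ∈ N}
  zero_mem' α := by simp [N.zero_mem]
  add_mem' hf hg α := by simpa using N.add_mem (hf α) (hg α)
  neg_mem' hf α := by simpa using N.neg_mem (hf α)

variable {E} {N : TwoSidedIdeal R}

theorem ι_mul_mem_coeffMem {r : R} (hr : r ∈ N) (a : A) : E.ι r * a ∈ E.coeffMem N := fun α => by
  rw [repr_ι_mul]
  exact N.mul_mem_right _ _ hr

theorem mul_mem_coeffMem_right {f : A} (hf : f ∈ E.coeffMem N) (a : A) :
    f * a ∈ E.coeffMem N := by
  rw [E.eq_sum_repr f, Finset.sum_mul]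
  refine sum_mem fun α _ => ?_
  rw [mul_assoc]
  exact ι_mul_mem_coeffMem (hf α) _

theorem mul_mem_coeffMem_left (hσ : ∀ i, ∀ r ∈ N, E.σ i r ∈ N) (hδ : ∀ i, ∀ r ∈ N, E.δ i r ∈ N)
    {f : A} (hf : f ∈ E.coeffMem N) (a : A) : a * f ∈ E.coeffMem N := by
  let S : Subring A :=
    { carrier := {a | ∀ f ∈ E.coeffMem N, a * f ∈ E.coeffMem N}
      zero_mem' := fun f _ => by rw [zero_mul]; exact zero_mem _
      one_mem' := fun f hf => by rwa [one_mul]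
      add_mem' := fun ha hb f hf => by rw [add_mul]; exact add_mem (ha f hf) (hb f hf)
      mul_mem' := fun ha hb f hf => by rw [mul_assoc]; exact ha _ (hb f hf)
      neg_mem' := fun ha f hf => by rw [neg_mul]; exact neg_mem (ha f hf) }
  refine E.mem_subring (S := S) (fun r f hf α => ?_) (fun i f hf => ?_) a f hf
  · rw [repr_ι_mul]
    exact N.mul_mem_left _ _ (hf α)
  · rw [E.eq_sum_repr f, Finset.mul_sum]
    refine sum_mem fun α _ => ?_
    rw [← mul_assoc, E.comm_rel, add_mul, mul_assoc]
    exact add_mem (ι_mul_mem_coeffMem (hσ i _ (hf α)) _) (ι_mul_mem_coeffMem (hδ i _ (hf α)) _)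

theorem eq_zero_of_mul_self_of_mem_coeffMem (hσ : ∀ i, ∀ r ∈ N, E.σ i r ∈ N)
    (hδ : ∀ i, ∀ r ∈ N, E.δ i r ∈ N) (hN : ∀ a ∈ N, IsNilpotent a) {h : A} (hh : h * h = h)
    (hmem : h ∈ E.coeffMem N) : h = 0 := by
  classical
  have key := N.eq_zero_of_eq_sum_mul hN (E.repr h).support (E.repr h)
    (fun α β => E.repr (monom E.x α * h) β) (fun α β => mul_mem_coeffMem_left hσ hδ hmem _ β)
    fun β _ => by
      conv_lhs => rw [← hh, E.eq_sum_repr h]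
      rw [Finset.sum_mul, map_sum, Finsupp.finsetSum_apply, ← E.eq_sum_repr h]
      exact Finset.sum_congr rfl fun α _ => by rw [mul_assoc, repr_ι_mul]
  rw [E.eq_sum_repr h]
  exact Finset.sum_eq_zero fun α hα => by rw [key α hα, map_zero, zero_mul]

variable (E) in
/-- The elements of `A` all of whose monomials have total degree less than `m`. -/
def degLT (m : ℕ) : AddSubgroup A where
  carrier := {f | ∀ α : Fin n → ℕ, m ≤ ∑ i, α i → E.repr f α = 0}
  zero_mem' α _ := by simp
  add_mem' hf hg α hα := by simp [hf α hα, hg α hα]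
  neg_mem' hf α hα := by simp [hf α hα]

theorem degLT_mono {m k : ℕ} (h : m ≤ k) : E.degLT m ≤ E.degLT k :=
  fun _ hf α hα => hf α (h.trans hα)

theorem ι_mul_mem_degLT {m : ℕ} (r : R) {f : A} (hf : f ∈ E.degLT m) : E.ι r * f ∈ E.degLT m :=
  fun α hα => by rw [repr_ι_mul, hf α hα, mul_zero]

theorem monom_mem_degLT {m : ℕ} {α : Fin n → ℕ} (h : ∑ i, α i < m) :
    monom E.x α ∈ E.degLT m := fun β hβ => by
  rw [repr_monom, Finsupp.single_apply, if_neg]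
  rintro rfl
  omega

theorem sum_add_single (β : Fin n → ℕ) (i : Fin n) :
    ∑ k, (β + Pi.single i 1 : Fin n → ℕ) k = ∑ k, β k + 1 := by
  simp [Finset.sum_add_distrib]

theorem exists_eq_add_single {β : Fin n → ℕ} {j : Fin n} (hj : β j ≠ 0) :
    ∃ β' : Fin n → ℕ, β = β' + Pi.single j 1 := by
  refine ⟨β - Pi.single j 1, funext fun k => ?_⟩
  by_cases hk : k = j
  · subst hk
    simp only [Pi.add_apply, Pi.sub_apply, Pi.single_eq_same]
    omega
  · simp [hk]

theorem x_mul_mem_degLT_of_monom {m : ℕ} {i : Fin n}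
    (H : ∀ β : Fin n → ℕ, ∑ k, β k < m → E.x i * monom E.x β ∈ E.degLT (m + 1))
    {f : A} (hf : f ∈ E.degLT m) : E.x i * f ∈ E.degLT (m + 1) := by
  rw [E.eq_sum_repr f, Finset.mul_sum]
  refine sum_mem fun α hα => ?_
  have hlt : ∑ k, α k < m := by
    by_contra! hle
    exact Finsupp.mem_support_iff.1 hα (hf α hle)
  rw [← mul_assoc, E.comm_rel, add_mul, mul_assoc]
  exact add_mem (ι_mul_mem_degLT _ (H α hlt))
    (ι_mul_mem_degLT _ (monom_mem_degLT (by omega)))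

theorem exists_x_mul_monom_sub_mem (hd : ∀ i j, i < j → IsUnit (E.d i j)) (i : Fin n)
    (β : Fin n → ℕ) : ∃ u : R, IsUnit u ∧
      E.x i * monom E.x β - E.ι u * monom E.x (β + Pi.single i 1) ∈ E.degLT (∑ k, β k + 1) := by
  induction hm : ∑ k, β k using Nat.strong_induction_on generalizing i β with
  | _ m ih =>
  by_cases hβ : ∀ k < i, β k = 0
  · exact ⟨1, isUnit_one, by simp [monom_add_single E.x β i hβ, zero_mem]⟩
  have hmul : ∀ (k : ℕ), k ≤ m → ∀ (i : Fin n) {f : A}, f ∈ E.degLT k →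
      E.x i * f ∈ E.degLT (k + 1) := by
    intro k hk i f hf
    refine x_mul_mem_degLT_of_monom (fun γ hγ => ?_) hf
    obtain ⟨u, -, hu⟩ := ih _ (hγ.trans_le hk) i γ rfl
    rw [← sub_add_cancel (E.x i * monom E.x γ) (E.ι u * monom E.x (γ + Pi.single i 1))]
    refine add_mem (degLT_mono (by omega) hu) (ι_mul_mem_degLT _ (monom_mem_degLT ?_))
    rw [sum_add_single]
    omega
  obtain ⟨j, ⟨hji, hj⟩, hmin⟩ : ∃ j, (j < i ∧ β j ≠ 0) ∧ ∀ k < j, β k = 0 := by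
    push Not at hβ
    obtain ⟨j, hj, hjmin⟩ := wellFounded_lt.has_min {k | k < i ∧ β k ≠ 0} hβ
    refine ⟨j, hj, fun k hk => ?_⟩
    by_contra hne
    exact hjmin k ⟨hk.trans hj.1, hne⟩ hk
  obtain ⟨β', rfl⟩ := exists_eq_add_single hj
  have hmin' : ∀ k < j, β' k = 0 := fun k hk => by
    have := hmin k hk
    simp only [Pi.add_apply] at this
    omega
  rw [sum_add_single] at hm
  obtain ⟨u, hu, hw⟩ := ih (∑ k, β' k) (by omega) i β' rfl
  obtain ⟨r0, rc, hq⟩ := E.quad j i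
  set w := E.x i * monom E.x β' - E.ι u * monom E.x (β' + Pi.single i 1) with hwdef
  have hmon : monom E.x (β' + Pi.single j 1 + Pi.single i 1) =
      E.x j * monom E.x (β' + Pi.single i 1) := by
    rw [add_right_comm]
    refine monom_add_single _ _ _ fun k hk => ?_
    simp [hmin' k hk, (hk.trans hji).ne]
  refine ⟨E.d j i * E.σ j u, (hd j i hji).mul (hu.map _), ?_⟩
  have hexp : E.x i * monom E.x (β' + Pi.single j 1) -
      E.ι (E.d j i * E.σ j u) * monom E.x (β' + Pi.single j 1 + Pi.single i 1) =
      E.ι (E.d j i) * (E.ι (E.δ j u) * monom E.x (β' + Pi.single i 1) + E.x j * w) +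
      (E.ι r0 * monom E.x β' + ∑ k, E.ι (rc k) * (E.x k * monom E.x β')) := by
    have h1 : E.x i * monom E.x β' = E.ι u * monom E.x (β' + Pi.single i 1) + w := by
      rw [hwdef]; abel
    have h2 : E.ι r0 * monom E.x β' + ∑ k, E.ι (rc k) * (E.x k * monom E.x β') =
        (E.ι r0 + ∑ k, E.ι (rc k) * E.x k) * monom E.x β' := by
      simp only [add_mul, Finset.sum_mul, mul_assoc]
    have h3 : E.x j * (E.x i * monom E.x β') = E.ι (E.σ j u) * (E.x j *
        monom E.x (β' + Pi.single i 1)) + E.ι (E.δ j u) * monom E.x (β' + Pi.single i 1) +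
        E.x j * w := by
      rw [h1, mul_add, ← mul_assoc, E.comm_rel, add_mul, mul_assoc]
    rw [h2, ← hq, hmon, monom_add_single E.x β' j hmin', sub_mul, mul_assoc, mul_assoc, mul_assoc,
      h3, map_mul]
    simp only [mul_add, mul_assoc]
    abel
  rw [hexp]
  have hsum : ∑ k, (β' + Pi.single i 1 : Fin n → ℕ) k < m + 1 := by
    rw [sum_add_single]
    omega
  refine add_mem (ι_mul_mem_degLT _ (add_mem (ι_mul_mem_degLT _ (monom_mem_degLT hsum))
    (degLT_mono (by omega) (hmul _ (by omega) j hw))))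
    (add_mem (ι_mul_mem_degLT _ (monom_mem_degLT (by omega)))
      (sum_mem fun k _ => ι_mul_mem_degLT _ ?_))
  exact hmul m le_rfl k (monom_mem_degLT (by omega))

theorem x_mul_mem_degLT (hd : ∀ i j, i < j → IsUnit (E.d i j)) (i : Fin n) {m : ℕ} {f : A}
    (hf : f ∈ E.degLT m) : E.x i * f ∈ E.degLT (m + 1) := by
  refine x_mul_mem_degLT_of_monom (fun γ hγ => ?_) hf
  obtain ⟨u, -, hu⟩ := exists_x_mul_monom_sub_mem hd i γ
  rw [← sub_add_cancel (E.x i * monom E.x γ) (E.ι u * monom E.x (γ + Pi.single i 1))]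
  refine add_mem (degLT_mono (by omega) hu) (ι_mul_mem_degLT _ (monom_mem_degLT ?_))
  rw [sum_add_single]
  omega

theorem exists_monom_mul_sub_mem (hd : ∀ i j, i < j → IsUnit (E.d i j))
    (hN : ∀ i (t r : R), t * E.σ i r ∈ N → t * r ∈ N) (r : R) (α β : Fin n → ℕ) :
    ∃ s : R, (∀ t, t * s ∈ N → t * r ∈ N) ∧
      monom E.x α * (E.ι r * monom E.x β) - E.ι s * monom E.x (α + β) ∈
        E.degLT (∑ k, α k + ∑ k, β k) := by
  induction hm : ∑ k, α k generalizing α with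
  | zero =>
    obtain rfl : α = 0 := funext fun k => by simpa using (Finset.sum_eq_zero_iff.1 hm) k
    exact ⟨r, fun _ h => h, by simp [monom, zero_mem]⟩
  | succ m ih =>
    obtain ⟨j, α', rfl, hmin⟩ : ∃ j, ∃ α' : Fin n → ℕ, α = α' + Pi.single j 1 ∧
        ∀ k < j, α' k = 0 := by
      have hne : {k | α k ≠ 0}.Nonempty := by
        by_contra! h
        have : ∑ k, α k = 0 := Finset.sum_eq_zero fun k _ => by
          by_contra hk
          exact (h ▸ hk : k ∈ (∅ : Set (Fin n)))
        omega
      obtain ⟨j, hj, hjmin⟩ := wellFounded_lt.has_min _ hne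
      obtain ⟨α', rfl⟩ := exists_eq_add_single (show α j ≠ 0 from hj)
      refine ⟨j, α', rfl, fun k hk => ?_⟩
      by_contra h
      exact hjmin k (by simp [h]) hk
    rw [sum_add_single] at hm
    obtain ⟨s, hs, hw⟩ := ih α' (by omega)
    obtain ⟨u, hu, hv⟩ := exists_x_mul_monom_sub_mem hd j (α' + β)
    have hsum : ∑ k, (α' + β) k = m + ∑ k, β k := by
      simp only [Pi.add_apply, Finset.sum_add_distrib]
      omega
    rw [hsum] at hv
    refine ⟨E.σ j s * u, fun t ht => hs t (hN j t s ?_), ?_⟩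
    · obtain ⟨v, huv⟩ := hu.exists_right_inv
      have := N.mul_mem_right _ v ht
      rwa [← mul_assoc, mul_assoc, huv, mul_one] at this
    · have hexp : monom E.x (α' + Pi.single j 1) * (E.ι r * monom E.x β) -
          E.ι (E.σ j s * u) * monom E.x (α' + Pi.single j 1 + β) =
          E.x j * (monom E.x α' * (E.ι r * monom E.x β) - E.ι s * monom E.x (α' + β)) +
          (E.ι (E.σ j s) * (E.x j * monom E.x (α' + β) -
            E.ι u * monom E.x (α' + β + Pi.single j 1)) +
          E.ι (E.δ j s) * monom E.x (α' + β)) := by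
        rw [monom_add_single E.x α' j hmin, add_right_comm α', mul_sub (E.x j),
          ← mul_assoc (E.x j) (E.ι s), E.comm_rel, map_mul]
        simp only [add_mul, mul_sub, mul_assoc]
        abel
      rw [hexp, show m + 1 + ∑ k, β k = m + ∑ k, β k + 1 by omega]
      exact add_mem (x_mul_mem_degLT hd j hw) (add_mem (ι_mul_mem_degLT _ hv)
        (ι_mul_mem_degLT _ (monom_mem_degLT (by omega))))

theorem eq_and_eq_of_add_eq_add_self {α β γ : Fin n → ℕ} (h : α + β = γ + γ)
    (hα : ∑ k, α k ^ 2 ≤ ∑ k, γ k ^ 2) (hβ : ∑ k, β k ^ 2 ≤ ∑ k, γ k ^ 2) : α = γ ∧ β = γ := by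
  have hk : ∀ k, α k + β k = γ k + γ k := fun k => congrFun h k
  have hle : ∑ k, ((α k : ℤ) - β k) ^ 2 ≤ 0 := by
    have h1 : ∑ k, ((α k : ℤ) - β k) ^ 2 =
        2 * ∑ k, (α k : ℤ) ^ 2 + 2 * ∑ k, (β k : ℤ) ^ 2 - 4 * ∑ k, (γ k : ℤ) ^ 2 := by
      simp only [Finset.mul_sum, ← Finset.sum_add_distrib, ← Finset.sum_sub_distrib]
      refine Finset.sum_congr rfl fun k _ => ?_
      have h2 : (α k : ℤ) + β k = γ k + γ k := mod_cast hk k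
      linear_combination (-(α k : ℤ) - β k - 2 * γ k) * h2
    zify at hα hβ
    linarith
  have hz := (Finset.sum_eq_zero_iff_of_nonneg fun k _ => sq_nonneg _).1
    (le_antisymm hle (Finset.sum_nonneg fun k _ => sq_nonneg ((α k : ℤ) - β k)))
  have hab : ∀ k, α k = β k := fun k => by
    have := pow_eq_zero_iff two_ne_zero |>.1 (hz k (Finset.mem_univ k))
    omega
  exact ⟨funext fun k => by have := hk k; have := hab k; omega,
    funext fun k => by have := hk k; have := hab k; omega⟩

/-- Modulo a completely semiprime `σ`-rigid ideal, idempotents of `A` are constants. -/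
theorem repr_mem_of_mul_self (hd : ∀ i j, i < j → IsUnit (E.d i j))
    (hσ : ∀ i, ∀ r ∈ N, E.σ i r ∈ N) (hδ : ∀ i, ∀ r ∈ N, E.δ i r ∈ N)
    (hN : ∀ i (t r : R), t * E.σ i r ∈ N → t * r ∈ N) (hsq : ∀ r, r * r ∈ N → r ∈ N)
    {f : A} (hf : f * f = f) {α : Fin n → ℕ} (hα : α ≠ 0) : E.repr f α ∈ N := by
  classical
  by_contra hαN
  have hsupp : ∀ β, E.repr f β ∉ N → β ∈ (E.repr f).support := fun β hβ =>
    Finsupp.mem_support_iff.2 fun h => hβ (h ▸ N.zero_mem)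
  set S := (E.repr f).support.filter fun β => E.repr f β ∉ N with hS
  have hmemS : ∀ β, E.repr f β ∉ N → β ∈ S := fun β hβ =>
    Finset.mem_filter.2 ⟨hsupp β hβ, hβ⟩
  obtain ⟨γ, hγS, hmax⟩ := S.exists_max_image
    (fun β => toLex (∑ k, β k, ∑ k, β k ^ 2)) ⟨α, hmemS α hαN⟩
  have hmax' : ∀ β, E.repr f β ∉ N → ∑ k, β k < ∑ k, γ k ∨
      ∑ k, β k = ∑ k, γ k ∧ ∑ k, β k ^ 2 ≤ ∑ k, γ k ^ 2 := fun β hβ => by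
    simpa [Prod.Lex.toLex_le_toLex] using hmax β (hmemS β hβ)
  have hγN : E.repr f γ ∉ N := (Finset.mem_filter.1 hγS).2
  have hpos : 0 < ∑ k, γ k := by
    have h0 : 0 < ∑ k, α k := by
      refine Nat.pos_of_ne_zero fun h => hα (funext fun k => ?_)
      simpa using Finset.sum_eq_zero_iff.1 h k
    rcases hmax' α hαN with h | h <;> omega
  have hsumγ : ∑ k, (γ + γ) k = ∑ k, γ k + ∑ k, γ k := by
    simp only [Pi.add_apply, Finset.sum_add_distrib]
  have hfγ : E.repr f (γ + γ) ∈ N := by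
    by_contra h
    rcases hmax' _ h with h | h <;> omega
  have hterm : ∀ β₁ β₂, (β₁, β₂) ≠ (γ, γ) →
      E.repr (E.ι (E.repr f β₁) * monom E.x β₁ * (E.ι (E.repr f β₂) * monom E.x β₂)) (γ + γ)
        ∈ N := by
    intro β₁ β₂ hne
    by_cases h1 : E.repr f β₁ ∈ N
    · rw [mul_assoc]
      exact ι_mul_mem_coeffMem h1 _ _
    by_cases h2 : E.repr f β₂ ∈ N
    · exact mul_mem_coeffMem_left hσ hδ (ι_mul_mem_coeffMem h2 _) _ _
    obtain ⟨s, -, hs⟩ := exists_monom_mul_sub_mem hd hN (E.repr f β₂) β₁ β₂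
    have hneq : β₁ + β₂ ≠ γ + γ := fun h => by
      have hsum : ∑ k, β₁ k + ∑ k, β₂ k = ∑ k, γ k + ∑ k, γ k := by
        rw [← hsumγ, ← h]
        simp only [Pi.add_apply, Finset.sum_add_distrib]
      have ha := hmax' β₁ h1
      have hb := hmax' β₂ h2
      obtain ⟨rfl, rfl⟩ := eq_and_eq_of_add_eq_add_self h (by omega) (by omega)
      exact hne rfl
    have h0 := hs (γ + γ) (by
      have ha := hmax' β₁ h1
      have hb := hmax' β₂ h2
      omega)
    rw [map_sub, repr_ι_mul_monom, Finsupp.sub_apply, Finsupp.single_apply, if_neg hneq,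
      sub_zero] at h0
    rw [mul_assoc, repr_ι_mul, h0, mul_zero]
    exact N.zero_mem
  obtain ⟨s, hs, hs'⟩ := exists_monom_mul_sub_mem hd hN (E.repr f γ) γ γ
  have hlead : E.repr (E.ι (E.repr f γ) * monom E.x γ * (E.ι (E.repr f γ) * monom E.x γ))
      (γ + γ) = E.repr f γ * s := by
    have h0 := hs' (γ + γ) hsumγ.ge
    rw [map_sub, repr_ι_mul_monom, Finsupp.sub_apply, Finsupp.single_eq_same,
      sub_eq_zero] at h0
    rw [mul_assoc, repr_ι_mul, h0]
  refine hγN (hsq _ (hs _ ?_))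
  rw [← hf] at hfγ
  conv at hfγ => rw [E.eq_sum_repr f]
  rw [Finset.sum_mul_sum, ← Finset.sum_product', map_sum, Finsupp.finsetSum_apply,
    ← Finset.add_sum_erase _ _ (Finset.mk_mem_product (hsupp γ hγN) (hsupp γ hγN)), hlead] at hfγ
  refine (add_mem_cancel_right ?_).1 hfγ
  exact sum_mem fun p hp => hterm p.1 p.2 (Finset.ne_of_mem_erase hp)

theorem monom_single (i : Fin n) : monom E.x (Pi.single i 1) = E.x i := by
  have h := monom_add_single E.x 0 i fun _ _ => rfl
  simpa [monom] using h

theorem isUnit_d (hAb : IsAbelianRing R) {i j : Fin n} (hij : i < j) : IsUnit (E.d i j) := by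
  classical
  set γ : Fin n → ℕ := Pi.single j 1 + Pi.single i 1 with hγ
  have hsum : ∑ k, γ k = 2 := by
    rw [hγ, sum_add_single]
    simp
  have hmon : monom E.x γ = E.x i * E.x j := by
    rw [hγ, monom_add_single _ _ _ fun k hk => by simp [(hk.trans hij).ne], monom_single]
  have hlin : ∀ k l, E.repr (E.x l * E.x k) γ = E.d k l * E.repr (E.x k * E.x l) γ := by
    intro k l
    obtain ⟨r0, rc, hq⟩ := E.quad k l
    have hmem : E.ι r0 + ∑ k, E.ι (rc k) * E.x k ∈ E.degLT 2 := by
      refine add_mem ?_ (sum_mem fun k _ => ι_mul_mem_degLT _ ?_)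
      · have : monom E.x 0 ∈ E.degLT 2 := monom_mem_degLT (by simp)
        simpa [monom] using ι_mul_mem_degLT r0 this
      · rw [← monom_single]
        exact monom_mem_degLT (by simp)
    have h0 := hmem γ hsum.ge
    rwa [← hq, map_sub, Finsupp.sub_apply, repr_ι_mul, sub_eq_zero] at h0
  have h1 := hlin j i
  rw [hlin i j, ← hmon, repr_monom, Finsupp.single_eq_same, mul_one] at h1
  exact hAb.isUnit_of_mul_eq_one h1.symm

namespace SigmaDeltaCompatible

theorem mul_σ_eq_zero_iff (hE : E.SigmaDeltaCompatible) (i : Fin n) {a b : R} :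
    a * E.σ i b = 0 ↔ a * b = 0 := by
  have h := (hE a b (Pi.single i 1)).1
  rw [sigmaPow, foldr_comp_ofFn_iterate_single fun k => ⇑(E.σ k)] at h
  exact h.symm

theorem mul_δ_eq_zero (hE : E.SigmaDeltaCompatible) (i : Fin n) {a b : R}
    (hab : a * b = 0) : a * E.δ i b = 0 := by
  have h := (hE a b (Pi.single i 1)).2 hab
  rwa [deltaPow, foldr_comp_ofFn_iterate_single] at h

theorem mul_σ_mul_eq_zero_iff (hE : E.SigmaDeltaCompatible) (i : Fin n)
    {a b c : R} : a * E.σ i b * c = 0 ↔ a * b * c = 0 := by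
  rw [← hE.mul_σ_eq_zero_iff i, mul_assoc, ← map_mul, hE.mul_σ_eq_zero_iff i, mul_assoc]

theorem mul_δ_mul_eq_zero (hE : E.SigmaDeltaCompatible) (i : Fin n) {a b c : R}
    (h : a * b * c = 0) : a * E.δ i b * c = 0 := by
  have h1 : a * E.δ i (b * c) = 0 := hE.mul_δ_eq_zero i (by rwa [← mul_assoc])
  have h2 : a * E.σ i b * E.δ i c = 0 :=
    hE.mul_δ_eq_zero i ((hE.mul_σ_mul_eq_zero_iff i).2 h)
  rwa [E.δ_leibniz, mul_add, ← mul_assoc, h2, zero_add, ← mul_assoc] at h1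

theorem isNilpotent_δ (hE : E.SigmaDeltaCompatible) (i : Fin n) {r : R}
    (hr : IsNilpotent r) : IsNilpotent (E.δ i r) :=
  hr.imp fun _ hk => pow_eq_zero_of_forall_mul_mul (fun _ _ => hE.mul_δ_mul_eq_zero i) hk

theorem isNilpotent_mul_of_isNilpotent_mul_σ (hE : E.SigmaDeltaCompatible) (i : Fin n)
    {a b : R} (h : IsNilpotent (a * E.σ i b)) : IsNilpotent (a * b) :=
  h.imp fun _ hk => pow_eq_zero_of_forall_mul_mul (fun u v huv => by
    rw [← mul_assoc] at huv ⊢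
    exact (hE.mul_σ_mul_eq_zero_iff i).1 huv) hk

theorem σ_eq_self (hE : E.SigmaDeltaCompatible) (i : Fin n) {e : R}
    (he : e * e = e) : E.σ i e = e := by
  have h1 : e * E.σ i (1 - e) = 0 :=
    (hE.mul_σ_eq_zero_iff i).2 (by rw [mul_sub, mul_one, he, sub_self])
  have h2 : (1 - e) * E.σ i e = 0 :=
    (hE.mul_σ_eq_zero_iff i).2 (by rw [sub_mul, one_mul, he, sub_self])
  rw [map_sub, map_one, mul_sub, mul_one, sub_eq_zero] at h1
  rw [sub_mul, one_mul, sub_eq_zero] at h2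
  rw [h2, ← h1]

theorem δ_eq_zero (hE : E.SigmaDeltaCompatible) (i : Fin n) {e : R}
    (he : e * e = e) : E.δ i e = 0 := by
  have h1 : e * E.δ i e = E.δ i e := by
    have h := hE.mul_δ_eq_zero i (a := 1 - e) (b := e) (by rw [sub_mul, one_mul, he, sub_self])
    rw [sub_mul, one_mul, sub_eq_zero] at h
    exact h.symm
  have h2 : e * E.δ i (1 - e) = 0 :=
    hE.mul_δ_eq_zero i (by rw [mul_sub, mul_one, he, sub_self])
  have h3 : E.δ i 1 = 0 := by
    have h := E.δ_leibniz i 1 1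
    simpa using h
  have h4 := E.δ_add i (1 - e) e
  rw [sub_add_cancel, h3] at h4
  rw [← h1, ← zero_add (e * E.δ i e)]
  nth_rw 1 [← h2]
  rw [← mul_add, ← h4, mul_zero]

theorem commute_ι (hE : E.SigmaDeltaCompatible) (hAb : IsAbelianRing R) {e : R}
    (he : e * e = e) (a : A) : Commute (E.ι e) a := by
  have h : a ∈ Subring.centralizer {E.ι e} := by
    refine E.mem_subring (fun r => ?_) (fun i => ?_) a <;>
      rw [Subring.mem_centralizer_iff] <;> rintro _ rfl
    · rw [← map_mul, ← map_mul, hAb e he r]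
    · rw [E.comm_rel, hE.σ_eq_self i he, hE.δ_eq_zero i he, map_zero, add_zero]
  exact Subring.mem_centralizer_iff.1 h _ rfl

end SigmaDeltaCompatible

end SkewPBWExt

theorem IsNIRing.exists_twoSidedIdeal {R : Type*} [Ring R] (hNI : IsNIRing R) :
    ∃ N : TwoSidedIdeal R, ∀ a, a ∈ N ↔ IsNilpotent a :=
  ⟨_, fun a => (Set.ext_iff.1 hNI a).symm⟩

theorem TwoSidedIdeal.exists_idempotent_sub_mem {R : Type*} [Ring R] {N : TwoSidedIdeal R}
    (hN : ∀ a ∈ N, IsNilpotent a) {r : R} (hr : r * r - r ∈ N) :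
    ∃ e : R, e * e = e ∧ r - e ∈ N := by
  have hmem : ∀ a, a ∈ N ↔ N.ringCon.mk' a = 0 := fun a => by
    rw [← TwoSidedIdeal.mem_ker, TwoSidedIdeal.ker_ringCon_mk']
  rw [hmem, map_sub, map_mul, sub_eq_zero] at hr
  obtain ⟨e, he, her⟩ := exists_isIdempotentElem_eq_of_ker_isNilpotent N.ringCon.mk'
    (fun a ha => hN a ((hmem a).2 ha)) _ ⟨r, rfl⟩ hr
  exact ⟨e, he, (hmem _).2 (by rw [map_sub, her, sub_self])⟩

/-- If `R` is `(Σ,Δ)`-compatible, Abelian and NI, then the skew PBW extension `A`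
is an Abelian ring. -/
theorem compatible_abelian_NI_isAbelian {R A : Type*} [Ring R] [Ring A] {n : ℕ} (E : SkewPBWExt R A n)
    (hcomp : E.SigmaDeltaCompatible) (hAb : IsAbelianRing R) (hNI : IsNIRing R) :
    IsAbelianRing A := by
  obtain ⟨N, hN⟩ := hNI.exists_twoSidedIdeal
  have hnil : ∀ a ∈ N, IsNilpotent a := fun a => (hN a).1
  have hσ : ∀ i, ∀ r ∈ N, E.σ i r ∈ N := fun i r hr => (hN _).2 ((hnil r hr).map (E.σ i))
  have hδ : ∀ i, ∀ r ∈ N, E.δ i r ∈ N := fun i r hr =>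
    (hN _).2 (hcomp.isNilpotent_δ i (hnil r hr))
  have hrigid : ∀ i (t r : R), t * E.σ i r ∈ N → t * r ∈ N := fun i t r h =>
    (hN _).2 (hcomp.isNilpotent_mul_of_isNilpotent_mul_σ i (hnil _ h))
  have hsq : ∀ r, r * r ∈ N → r ∈ N := fun r hr => by
    obtain ⟨k, hk⟩ := hnil _ hr
    exact (hN r).2 ⟨2 * k, by rw [pow_mul, pow_two, hk]⟩
  intro f hf a
  have hf0 : f - E.ι (E.repr f 0) ∈ E.coeffMem N := fun α => by
    rw [map_sub, SkewPBWExt.repr_ι, Finsupp.sub_apply]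
    by_cases hα : α = 0
    · simp [hα, N.zero_mem]
    · rw [Finsupp.single_eq_of_ne hα, sub_zero]
      exact SkewPBWExt.repr_mem_of_mul_self (fun _ _ => SkewPBWExt.isUnit_d hAb) hσ hδ hrigid
        hsq hf hα
  set r := E.repr f 0
  have hr : r * r - r ∈ N := by
    have h : E.ι (r * r - r) ∈ E.coeffMem N := by
      have hexp : E.ι (r * r - r) =
          (f - E.ι r) - ((f - E.ι r) * f + E.ι r * (f - E.ι r)) := by
        simp only [map_sub, map_mul, sub_mul, mul_sub, hf]
        abel
      rw [hexp]
      exact sub_mem hf0 (add_mem (SkewPBWExt.mul_mem_coeffMem_right hf0 f)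
        (SkewPBWExt.mul_mem_coeffMem_left hσ hδ hf0 _))
    have h0 := h 0
    rwa [SkewPBWExt.repr_ι, Finsupp.single_eq_same] at h0
  obtain ⟨e, he, hre⟩ := N.exists_idempotent_sub_mem hnil hr
  have hfe : f - E.ι e ∈ E.coeffMem N := by
    have h := SkewPBWExt.ι_mul_mem_coeffMem (E := E) hre 1
    rw [mul_one, map_sub] at h
    simpa using add_mem hf0 h
  have hcomm := hcomp.commute_ι hAb he
  have hee : E.ι e * E.ι e = E.ι e := by rw [← map_mul, he]
  have hfef : f * E.ι e * f = f * E.ι e := by rw [← (hcomm f).eq, mul_assoc, hf]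
  have h1 : f - f * E.ι e = 0 := by
    refine SkewPBWExt.eq_zero_of_mul_self_of_mem_coeffMem hσ hδ hnil ?_ ?_
    · rw [mul_sub, sub_mul, sub_mul, hf, ← mul_assoc, ← mul_assoc, hfef, hf, mul_assoc f, hee]
      abel
    · have h := SkewPBWExt.mul_mem_coeffMem_left hσ hδ hfe f
      rwa [mul_sub, hf] at h
  have h2 : E.ι e - f * E.ι e = 0 := by
    refine SkewPBWExt.eq_zero_of_mul_self_of_mem_coeffMem hσ hδ hnil ?_ ?_
    · rw [mul_sub, sub_mul, sub_mul, hee, ← mul_assoc, ← mul_assoc, hfef, (hcomm f).eq,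
        mul_assoc f, hee]
      abel
    · have h := neg_mem (SkewPBWExt.mul_mem_coeffMem_right hfe (E.ι e))
      rwa [sub_mul, hee, neg_sub] at h
  have hfe' : f = E.ι e := by rw [sub_eq_zero.1 h1, ← sub_eq_zero.1 h2]
  rw [hfe']
  exact (hcomm a).eq
end

section
/- Let R be a ring, Σ = {σ_1,…,σ_n} a family of ring endomorphisms of R, and Δ = {δ_1,…,δ_n} a family of maps with each δ_i a σ_i-derivation. If R is Σ-rigid (for all a ∈ R and α ∈ ℕ^n, aσ^α(a) = 0 implies a = 0), then R is reduced and R is (Σ,Δ)-compatible. -/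
theorem foldr_comp_ofFn_induction {R : Type*} (P : (R → R) → Prop) (hid : P id)
    (hcomp : ∀ f g, P f → P g → P (f ∘ g)) {n : ℕ} (f : Fin n → R → R) (hf : ∀ i, P (f i))
    (α : Fin n → ℕ) : P ((List.ofFn fun i => (f i)^[α i]).foldr (· ∘ ·) id) := by
  have hiter : ∀ g, P g → ∀ k : ℕ, P g^[k] := by
    intro g hg k
    induction k with
    | zero => exact hid
    | succ k ih => exact hcomp _ _ ih hg
  induction n with
  | zero => simpa using hid
  | succ n ih =>
    rw [List.ofFn_succ, List.foldr_cons]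
    exact hcomp _ _ (hiter _ (hf 0) _)
      (ih (fun i => f i.succ) (fun i => hf i.succ) (fun i => α i.succ))

theorem foldr_comp_ofFn_zero {R : Type*} {n : ℕ} (f : Fin n → R → R) :
    (List.ofFn fun i => (f i)^[0]).foldr (· ∘ ·) id = id := by
  induction n with
  | zero => simp
  | succ n ih =>
    rw [List.ofFn_succ, List.foldr_cons, ih (fun i => f i.succ)]
    rfl

theorem foldr_comp_ofFn_single {R : Type*} {n : ℕ} (f : Fin n → R → R) (i : Fin n) :
    (List.ofFn fun j => (f j)^[(Pi.single i 1 : Fin n → ℕ) j]).foldr (· ∘ ·) id = f i := by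
  induction n with
  | zero => exact i.elim0
  | succ n ih =>
    rw [List.ofFn_succ, List.foldr_cons]
    cases i using Fin.cases with
    | zero =>
      have h := foldr_comp_ofFn_zero fun i : Fin n => f i.succ
      simp only [Pi.single_eq_same, Pi.single_eq_of_ne (Fin.succ_ne_zero _)]
      rw [h]
      rfl
    | succ i =>
      have hs : ∀ j : Fin n, (Pi.single i.succ 1 : Fin (n + 1) → ℕ) j.succ =
          (Pi.single i 1 : Fin n → ℕ) j := by
        intro j
        simp [Pi.single_apply]
      simp only [hs, Pi.single_eq_of_ne (Fin.succ_ne_zero i).symm]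
      rw [ih (fun i => f i.succ) i]
      rfl

theorem sigmaPow_zero {R : Type*} [Ring R] {n : ℕ} (σ : Fin n → R →+* R) :
    sigmaPow σ 0 = id :=
  foldr_comp_ofFn_zero fun i => ⇑(σ i)

theorem exists_ringHom_coe_eq_sigmaPow {R : Type*} [Ring R] {n : ℕ} (σ : Fin n → R →+* R)
    (α : Fin n → ℕ) : ∃ s : R →+* R, ⇑s = sigmaPow σ α := by
  refine foldr_comp_ofFn_induction (fun g => ∃ s : R →+* R, ⇑s = g) ⟨RingHom.id R, rfl⟩ ?_
    (fun i => ⇑(σ i)) (fun i => ⟨σ i, rfl⟩) α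
  rintro _ _ ⟨s, rfl⟩ ⟨t, rfl⟩
  exact ⟨s.comp t, rfl⟩

theorem mul_eq_zero_symm_of_isReduced {R : Type*} [Ring R] [IsReduced R] {a b : R}
    (h : a * b = 0) : b * a = 0 := by
  refine pow_eq_zero_iff two_ne_zero |>.mp ?_
  rw [pow_two, mul_assoc, ← mul_assoc a, h, zero_mul, mul_zero]

/-- A rigid endomorphism of a reduced ring preserves and reflects the vanishing of products. -/
theorem mul_eq_zero_iff_mul_map_eq_zero {R : Type*} [Ring R] [IsReduced R] (s : R →+* R)
    (hs : ∀ a, a * s a = 0 → a = 0) (a b : R) : a * b = 0 ↔ a * s b = 0 := by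
  constructor
  · intro h
    apply hs
    rw [map_mul, mul_assoc, ← mul_assoc (s b), ← map_mul, mul_eq_zero_symm_of_isReduced h,
      map_zero, zero_mul, mul_zero]
  · intro h
    apply mul_eq_zero_symm_of_isReduced
    apply hs
    rw [map_mul, mul_assoc, ← mul_assoc a, h, zero_mul, mul_zero]

/-- A skew derivation over a rigid endomorphism preserves the vanishing of products. -/
theorem mul_skewDerivation_eq_zero {R : Type*} [Ring R] [IsReduced R] (s : R →+* R)
    (hs : ∀ a, a * s a = 0 → a = 0) (d : R → R)
    (hd : ∀ a b, d (a * b) = s a * d b + d a * b) {a b : R} (h : a * b = 0) :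
    a * d b = 0 := by
  have hd0 : d 0 = 0 := by simpa using hd 0 0
  have hsum : s a * d b + d a * b = 0 := by rw [← hd, h, hd0]
  have hbs : b * s a = 0 :=
    (mul_eq_zero_iff_mul_map_eq_zero s hs b a).mp (mul_eq_zero_symm_of_isReduced h)
  have hbdb : b * (d a * b) = 0 := by
    have := congrArg (b * ·) hsum
    simpa only [mul_add, ← mul_assoc, hbs, zero_mul, zero_add, mul_zero] using this
  have hdb : d a * b = 0 := by
    refine pow_eq_zero_iff two_ne_zero |>.mp ?_
    rw [pow_two, mul_assoc, hbdb, mul_zero]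
  rw [hdb, add_zero] at hsum
  exact mul_eq_zero_symm_of_isReduced
    ((mul_eq_zero_iff_mul_map_eq_zero s hs _ _).mpr (mul_eq_zero_symm_of_isReduced hsum))

/-- A `Σ`-rigid ring is reduced and `(Σ,Δ)`-compatible. -/
theorem sigmaRigid_reduced_compatible {R : Type*} [Ring R] {n : ℕ} (σ : Fin n → R →+* R) (δ : Fin n → R → R)
    (hδadd : ∀ (i : Fin n) (a b : R), δ i (a + b) = δ i a + δ i b)
    (hδleib : ∀ (i : Fin n) (a b : R), δ i (a * b) = σ i a * δ i b + δ i a * b)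
    (hrig : ∀ (a : R) (α : Fin n → ℕ), a * sigmaPow σ α a = 0 → a = 0) :
    IsReduced R ∧
      ∀ (a b : R) (α : Fin n → ℕ),
        (a * b = 0 ↔ a * sigmaPow σ α b = 0) ∧ (a * b = 0 → a * deltaPow δ α b = 0) := by
  have hred : IsReduced R := by
    refine isReduced_iff_pow_one_lt 2 one_lt_two |>.mpr fun a ha => hrig a 0 ?_
    rwa [sigmaPow_zero, id, ← pow_two]
  refine ⟨hred, fun a b α => ⟨?_, fun h => ?_⟩⟩
  · obtain ⟨s, hs⟩ := exists_ringHom_coe_eq_sigmaPow σ α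
    rw [← hs]
    exact mul_eq_zero_iff_mul_map_eq_zero s (fun c hc => hrig c α (hs ▸ hc)) a b
  · refine foldr_comp_ofFn_induction (fun g => ∀ b, a * b = 0 → a * g b = 0)
      (fun _ h => h) (fun f g hf hg b h => hf _ (hg b h)) δ (fun i b h => ?_) α b h
    exact mul_skewDerivation_eq_zero (σ i)
      (fun c hc => hrig c (Pi.single i 1) (by rwa [sigmaPow_single])) (δ i) (hδleib i) h
end
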